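/- Let α ≥ 4 be real and b > 1/2. There exists C > 0 (depending only on α and b) such that for every (ξ, μ, τ) ∈ ℝ³ with ξ ≠ 0, the integral I(ξ, μ, τ) := ∫ over the set {(ξ₁, μ₁, τ₁) : ξ₁ ≠ 0, ξ₂ := ξ − ξ₁ ≠ 0, |ξ₁| ≤ |ξ₂|/4, |σ − σ₁ − σ₂| ≥ |Δ|/α} of |ξ₁|^{-1} |ξ₂|^{α/2} ⟨σ₁⟩^{-2b} ⟨σ₂⟩^{-2b} dξ₁ dμ₁ dτ₁ satisfies I(ξ, μ, τ) ≤ C. (Paper's key kernel bound (2.015) in the proof of Lemma 2.4.) -/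

import Mathlib

open MeasureTheory

/-- The generalized KP-I dispersion relation `φ(ξ, μ) = ξ|ξ|^α + μ²/ξ`. -/
noncomputable def phi (α ξ μ : ℝ) : ℝ := ξ * |ξ| ^ α + μ ^ 2 / ξ

/-- The modulation `σ = τ + φ(ξ, μ)` of a point `p = (ξ, μ, τ)`. -/
noncomputable def sigma (α : ℝ) (p : ℝ × ℝ × ℝ) : ℝ := p.2.2 + phi α p.1 p.2.1

/-- Componentwise difference of two frequency-space points. -/
def sub3 (q p : ℝ × ℝ × ℝ) : ℝ × ℝ × ℝ := (q.1 - p.1, q.2.1 - p.2.1, q.2.2 - p.2.2)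

/-- `Δ = ξ|ξ|^α − ξ₁|ξ₁|^α − ξ₂|ξ₂|^α` with `ξ₂ = ξ − ξ₁`. -/
noncomputable def res (α ξ ξ₁ : ℝ) : ℝ :=
  ξ * |ξ| ^ α - ξ₁ * |ξ₁| ^ α - (ξ - ξ₁) * |ξ - ξ₁| ^ α

open scoped ENNReal

theorem hasDerivAt_mul_abs_rpow {α : ℝ} (hα : 1 < α) (x : ℝ) :
    HasDerivAt (fun y : ℝ ↦ y * |y| ^ α) ((α + 1) * |x| ^ α) x := by
  refine ((hasDerivAt_id' x).mul (hasDerivAt_abs_rpow x hα)).congr_deriv ?_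
  rcases eq_or_ne x 0 with rfl | hx
  · simp [Real.zero_rpow (by linarith : α ≠ 0)]
  · have h : |x| ^ α = |x| ^ (α - 2) * x ^ 2 := by
      rw [← sq_abs x, ← Real.rpow_natCast, ← Real.rpow_add (abs_pos.2 hx)]
      norm_num
    rw [h]; ring

theorem hasDerivAt_res {α : ℝ} (hα : 1 < α) (ξ x : ℝ) :
    HasDerivAt (res α ξ) ((α + 1) * (|ξ - x| ^ α - |x| ^ α)) x := by
  have h1 := hasDerivAt_mul_abs_rpow hα x
  have h2 := (hasDerivAt_mul_abs_rpow hα (ξ - x)).comp x ((hasDerivAt_id' x).const_sub ξ)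
  refine ((h1.const_sub (ξ * |ξ| ^ α)).sub h2).congr_deriv ?_
  ring

theorem abs_le_abs_sub_div_four_iff (ξ x : ℝ) :
    |x| ≤ |ξ - x| / 4 ↔ (5 * x - ξ) * (3 * x + ξ) ≤ 0 := by
  have : |x| ≤ |ξ - x| / 4 ↔ |4 * x| ≤ |ξ - x| := by
    rw [abs_mul, abs_of_pos (by norm_num : (0 : ℝ) < 4)]
    constructor <;> intro h <;> linarith
  rw [this, ← sq_le_sq]
  constructor <;> intro h <;> nlinarith

theorem convex_low_freq (ξ : ℝ) : Convex ℝ {x : ℝ | |x| ≤ |ξ - x| / 4} := by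
  intro x hx y hy a b ha hb hab
  simp only [Set.mem_ofPred_eq, abs_le_abs_sub_div_four_iff, smul_eq_mul] at *
  obtain rfl : b = 1 - a := by linarith
  nlinarith [mul_nonneg (mul_nonneg ha hb) (sq_nonneg (x - y)),
    mul_nonneg ha (neg_nonneg.2 hx), mul_nonneg hb (neg_nonneg.2 hy)]

theorem abs_sub_pos_of_low_freq {ξ x : ℝ} (hξ : ξ ≠ 0) (hx : |x| ≤ |ξ - x| / 4) :
    0 < |ξ - x| := by
  rw [abs_pos]
  intro h
  rw [h, abs_zero, zero_div] at hx
  have := abs_nonpos_iff.1 hx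
  exact hξ (by linarith)

theorem rpow_le_deriv_res {α ξ x : ℝ} (hα : 4 ≤ α) (hx : |x| ≤ |ξ - x| / 4) :
    |ξ - x| ^ α ≤ (α + 1) * (|ξ - x| ^ α - |x| ^ α) := by
  have h1 : |x| ^ α ≤ |ξ - x| ^ α / 4 := by
    calc |x| ^ α ≤ (|ξ - x| / 4) ^ α := by gcongr
      _ = |ξ - x| ^ α / 4 ^ α := Real.div_rpow (abs_nonneg _) (by norm_num) _
      _ ≤ |ξ - x| ^ α / 4 := by
        gcongr
        exact Real.self_le_rpow_of_one_le (by norm_num) (by linarith)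
  have h2 : 0 ≤ |ξ - x| ^ α := by positivity
  nlinarith

theorem strictMonoOn_res {α ξ : ℝ} (hα : 4 ≤ α) (hξ : ξ ≠ 0) :
    StrictMonoOn (res α ξ) {x : ℝ | |x| ≤ |ξ - x| / 4} := by
  have hd := hasDerivAt_res (by linarith : 1 < α) ξ
  refine strictMonoOn_of_deriv_pos (convex_low_freq ξ)
    (fun x _ ↦ (hd x).continuousAt.continuousWithinAt) fun x hx ↦ ?_
  have hx' := interior_subset hx
  rw [(hd x).deriv]
  exact (Real.rpow_pos_of_pos (abs_sub_pos_of_low_freq hξ hx') α).trans_le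
    (rpow_le_deriv_res hα hx')

theorem res_zero {α ξ : ℝ} : res α ξ 0 = 0 := by simp [res]

theorem res_ne_zero {α ξ x : ℝ} (hα : 4 ≤ α) (hξ : ξ ≠ 0) (hx : |x| ≤ |ξ - x| / 4)
    (hx0 : x ≠ 0) : res α ξ x ≠ 0 := by
  intro h
  refine hx0 ((strictMonoOn_res hα hξ).injOn hx ?_ (h.trans res_zero.symm))
  simp only [Set.mem_ofPred_eq, abs_zero]
  positivity

theorem abs_res_le {α ξ x : ℝ} (hα : 4 ≤ α) (hx : |x| ≤ |ξ - x| / 4) :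
    |res α ξ x| ≤ (α + 1) * 2 ^ α * (|x| * |ξ - x| ^ α) := by
  have h0 : (0 : ℝ) ∈ {x : ℝ | |x| ≤ |ξ - x| / 4} := by
    simp only [Set.mem_ofPred_eq, abs_zero]
    positivity
  have hsub := (convex_low_freq ξ).segment_subset h0 hx
  have key := Convex.norm_image_sub_le_of_norm_hasDerivWithin_le
    (f := res α ξ) (C := (α + 1) * 2 ^ α * |ξ - x| ^ α) (s := segment ℝ 0 x)
    (fun y _ ↦ (hasDerivAt_res (by linarith : 1 < α) ξ y).hasDerivWithinAt) ?_
    (convex_segment 0 x) (left_mem_segment ℝ 0 x) (right_mem_segment ℝ 0 x)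
  · rw [res_zero, sub_zero, sub_zero, Real.norm_eq_abs, Real.norm_eq_abs] at key
    linarith
  · intro y hy
    have hyA := hsub hy
    have h1 := rpow_le_deriv_res hα hyA
    have h2 : 0 ≤ |ξ - y| ^ α := by positivity
    have h3 : 0 ≤ |y| ^ α := by positivity
    have hyx : |x - y| ≤ |x| := by
      rw [segment_eq_uIcc] at hy
      simpa using Set.abs_sub_right_of_mem_uIcc hy
    have h4 : |ξ - y| ≤ 2 * |ξ - x| := by
      have : |ξ - y| ≤ |ξ - x| + |x - y| := by
        simpa using abs_add_le (ξ - x) (x - y)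
      have := abs_nonneg (ξ - x)
      linarith
    rw [Real.norm_eq_abs, abs_of_nonneg (h2.trans h1), mul_assoc]
    gcongr
    calc |ξ - y| ^ α - |y| ^ α ≤ |ξ - y| ^ α := by linarith
      _ ≤ (2 * |ξ - x|) ^ α := by gcongr
      _ = 2 ^ α * |ξ - x| ^ α := Real.mul_rpow (by norm_num) (abs_nonneg _)

theorem sigma_add_sigma_sub3 {α ξ μ τ x m t : ℝ} (hξ : ξ ≠ 0) (hx : x ≠ 0)
    (hξx : ξ - x ≠ 0) :
    sigma α (x, m, t) + sigma α (sub3 (ξ, μ, τ) (x, m, t)) =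
      sigma α (ξ, μ, τ) - res α ξ x + ξ / (x * (ξ - x)) * (m - x * μ / ξ) ^ 2 := by
  simp only [sigma, sub3, phi, res]
  field_simp
  ring

theorem prefactor_le {α ξ x : ℝ} (hα : 4 ≤ α) (hξ : ξ ≠ 0) (hx : |x| ≤ |ξ - x| / 4)
    (hx0 : x ≠ 0) (y : ℝ) :
    |x|⁻¹ * |ξ - x| ^ (α / 2) * (√|ξ / (x * (ξ - x)) * y|)⁻¹ ≤
      √(4 / 3 * ((α + 1) * 2 ^ α)) *
        (|(α + 1) * (|ξ - x| ^ α - |x| ^ α)| * ((√|res α ξ x|)⁻¹ * (√|y|)⁻¹)) := by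
  have hz := abs_sub_pos_of_low_freq hξ hx
  have hxp := abs_pos.2 hx0
  have hr := Real.sqrt_pos.2 (abs_pos.2 (res_ne_zero hα hξ hx hx0))
  have hκ : 3 / 4 / |x| ≤ |ξ / (x * (ξ - x))| := by
    rw [abs_div, abs_mul, div_le_div_iff₀ hxp (by positivity)]
    have : 3 / 4 * |ξ - x| ≤ |ξ| := by
      have := abs_sub_abs_le_abs_sub (ξ - x) (-x)
      simp only [abs_neg, sub_neg_eq_add, sub_add_cancel] at this
      linarith
    nlinarith
  have hD := (rpow_le_deriv_res hα hx).trans (le_abs_self _)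
  have hpow : |ξ - x| ^ (α / 2) = √(|ξ - x| ^ α) := by
    rw [Real.sqrt_eq_rpow, ← Real.rpow_mul hz.le]; ring_nf
  have hP : 0 < |ξ - x| ^ α := Real.rpow_pos_of_pos hz α
  have hκp : 0 < 3 / 4 / |x| := by positivity
  have hmain : |x|⁻¹ * |ξ - x| ^ (α / 2) * (√|ξ / (x * (ξ - x))|)⁻¹ * √|res α ξ x| ≤
      √(4 / 3 * ((α + 1) * 2 ^ α)) * |ξ - x| ^ α := by
    calc |x|⁻¹ * |ξ - x| ^ (α / 2) * (√|ξ / (x * (ξ - x))|)⁻¹ * √|res α ξ x|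
        ≤ |x|⁻¹ * √(|ξ - x| ^ α) * (√(3 / 4 / |x|))⁻¹ *
          √((α + 1) * 2 ^ α * (|x| * |ξ - x| ^ α)) := by
          rw [hpow]
          have := Real.sqrt_pos.2 hκp
          have := abs_res_le hα hx
          gcongr
      _ = |x|⁻¹ * √(|ξ - x| ^ α * (3 / 4 / |x|)⁻¹ *
          ((α + 1) * 2 ^ α * (|x| * |ξ - x| ^ α))) := by
          rw [Real.sqrt_mul (x := |ξ - x| ^ α * (3 / 4 / |x|)⁻¹) (by positivity),
            Real.sqrt_mul hP.le, Real.sqrt_inv]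
          ring
      _ = |x|⁻¹ * √(4 / 3 * ((α + 1) * 2 ^ α) * (|x| * |ξ - x| ^ α) ^ 2) := by
          congr 2
          field_simp
      _ = √(4 / 3 * ((α + 1) * 2 ^ α)) * |ξ - x| ^ α := by
          rw [Real.sqrt_mul (by positivity), Real.sqrt_sq (by positivity)]
          field_simp
  rw [abs_mul _ y, Real.sqrt_mul (abs_nonneg _), mul_inv]
  calc |x|⁻¹ * |ξ - x| ^ (α / 2) * ((√|ξ / (x * (ξ - x))|)⁻¹ * (√|y|)⁻¹)
      = |x|⁻¹ * |ξ - x| ^ (α / 2) * (√|ξ / (x * (ξ - x))|)⁻¹ * √|res α ξ x| *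
        ((√|res α ξ x|)⁻¹ * (√|y|)⁻¹) := by field_simp
    _ ≤ √(4 / 3 * ((α + 1) * 2 ^ α)) * |ξ - x| ^ α * ((√|res α ξ x|)⁻¹ * (√|y|)⁻¹) := by
      gcongr
    _ ≤ _ := by
      rw [mul_assoc]
      gcongr

theorem lintegral_comp_mul_sq_le {κ : ℝ} (hκ : κ ≠ 0) (H : ℝ → ℝ≥0∞) :
    ∫⁻ v : ℝ, H (κ * v ^ 2) ≤ ∫⁻ y : ℝ, H y * ENNReal.ofReal (√|κ * y|)⁻¹ := by
  set g : ℝ → ℝ≥0∞ := fun y ↦ H y * ENNReal.ofReal (√|κ * y|)⁻¹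
  have half : ∀ s : Set ℝ, MeasurableSet s → Set.InjOn (fun v : ℝ ↦ κ * v ^ 2) s →
      (∀ v ∈ s, v ≠ 0) → 2 * ∫⁻ v in s, H (κ * v ^ 2) ≤ ∫⁻ y, g y := by
    intro s hs hinj hne
    have h := lintegral_image_eq_lintegral_abs_deriv_mul hs
      (f := fun v : ℝ ↦ κ * v ^ 2) (f' := fun v ↦ κ * (2 * v))
      (fun v _ ↦ (((hasDerivAt_pow 2 v).const_mul κ).congr_deriv (by simp)).hasDerivWithinAt)
      hinj g
    calc 2 * ∫⁻ v in s, H (κ * v ^ 2)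
        = ∫⁻ v in s, 2 * H (κ * v ^ 2) := (lintegral_const_mul' _ _ (by simp)).symm
      _ = ∫⁻ v in s, ENNReal.ofReal |κ * (2 * v)| * g (κ * v ^ 2) := by
        refine setLIntegral_congr_fun hs fun v hv ↦ ?_
        have hv0 := hne v hv
        have : √|κ * (κ * v ^ 2)| = |κ * v| := by
          rw [show κ * (κ * v ^ 2) = (κ * v) ^ 2 by ring, abs_of_nonneg (sq_nonneg _),
            Real.sqrt_sq_eq_abs]
        simp only [g, this]
        rw [mul_left_comm, ← ENNReal.ofReal_mul (abs_nonneg _)]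
        have h2 : |κ * (2 * v)| * |κ * v|⁻¹ = 2 := by
          rw [show κ * (2 * v) = 2 * (κ * v) by ring, abs_mul, abs_two, mul_assoc,
            mul_inv_cancel₀ (abs_ne_zero.2 (mul_ne_zero hκ hv0)), mul_one]
        rw [h2, mul_comm]
        simp
      _ = ∫⁻ y in (fun v : ℝ ↦ κ * v ^ 2) '' s, g y := h.symm
      _ ≤ ∫⁻ y, g y := setLIntegral_le_lintegral _ _
  have hsq : ∀ u v : ℝ, κ * u ^ 2 = κ * v ^ 2 → u = v ∨ u = -v := fun u v h ↦
    sq_eq_sq_iff_eq_or_eq_neg.1 (mul_left_cancel₀ hκ h)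
  have hpos := half (Set.Ioi 0) measurableSet_Ioi
    (fun u hu v hv h ↦ (hsq u v h).resolve_right fun h' ↦ by
      simp only [Set.mem_Ioi] at hu hv; linarith) fun v hv ↦ (Set.mem_Ioi.1 hv).ne'
  have hneg := half (Set.Iio 0) measurableSet_Iio
    (fun u hu v hv h ↦ (hsq u v h).resolve_right fun h' ↦ by
      simp only [Set.mem_Iio] at hu hv; linarith) fun v hv ↦ (Set.mem_Iio.1 hv).ne
  rw [← lintegral_add_compl _ (measurableSet_Ioi (a := (0 : ℝ))), Set.compl_Ioi,
    setLIntegral_congr (Iio_ae_eq_Iic (a := (0 : ℝ)) (μ := volume)).symm]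
  rw [← ENNReal.mul_le_mul_iff_right (a := 2) (by simp) (by simp), mul_add, two_mul (∫⁻ y, g y)]
  exact add_le_add hpos hneg

theorem lintegral_inv_sqrt_abs_lt_top (R : ℝ) :
    ∫⁻ x in Set.Icc (-R) R, ENNReal.ofReal (√|x|)⁻¹ < ∞ := by
  have hpos : ∫⁻ x in Set.Ioc 0 R, ENNReal.ofReal (√|x|)⁻¹ < ∞ := by
    rcases le_total R 0 with hR | hR
    · simp [hR]
    have h := (intervalIntegral.intervalIntegrable_rpow' (r := -(1 / 2)) (a := 0) (b := R)
      (by norm_num)).1.lintegral_lt_top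
    refine lt_of_eq_of_lt (setLIntegral_congr_fun measurableSet_Ioc fun x hx ↦ ?_) h
    rw [abs_of_pos hx.1, Real.sqrt_eq_rpow, Real.rpow_neg hx.1.le]
  have hneg : ∫⁻ x in Set.Ico (-R) 0, ENNReal.ofReal (√|x|)⁻¹ < ∞ := by
    have := (Measure.measurePreserving_neg (volume : Measure ℝ)).setLIntegral_comp_preimage_emb
      (MeasurableEquiv.neg ℝ).measurableEmbedding (fun x ↦ ENNReal.ofReal (√|x|)⁻¹)
      (Set.Ioc 0 R)
    simp only [abs_neg, Set.neg_preimage, Set.neg_Ioc, neg_zero] at this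
    rwa [this]
  refine (lintegral_mono_set (t := Set.Ico (-R) 0 ∪ {0} ∪ Set.Ioc 0 R) ?_).trans_lt ?_
  · rintro x ⟨h1, h2⟩
    rcases lt_trichotomy x 0 with h | h | h
    · exact Or.inl (Or.inl ⟨h1, h⟩)
    · exact Or.inl (Or.inr h)
    · exact Or.inr ⟨h, h2⟩
  · refine (lintegral_union_le _ _ _).trans_lt (ENNReal.add_lt_top.2 ⟨?_, hpos⟩)
    refine (lintegral_union_le _ _ _).trans_lt (ENNReal.add_lt_top.2 ⟨hneg, by simp⟩)

/-- The kernel `|y|^{-1/2} |y - w|^{-1/2}` cut off to `|y| ≤ α |w|`. -/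
noncomputable def cutKernel (α w y : ℝ) : ℝ≥0∞ :=
  {z : ℝ | |z| ≤ α * |w|}.indicator (fun z ↦ ENNReal.ofReal ((√|z|)⁻¹ * (√|z - w|)⁻¹)) y

theorem lintegral_cutKernel_one_lt_top (α : ℝ) : ∫⁻ y, cutKernel α 1 y < ∞ := by
  have hle : ∀ y ∈ Set.Icc (-α) α, ENNReal.ofReal ((√|y|)⁻¹ * (√|y - 1|)⁻¹) ≤
      ENNReal.ofReal 2 * (ENNReal.ofReal (√|y|)⁻¹ + ENNReal.ofReal (√|y - 1|)⁻¹) := by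
    intro y _
    rw [← ENNReal.ofReal_add (by positivity) (by positivity),
      ← ENNReal.ofReal_mul (by norm_num)]
    refine ENNReal.ofReal_le_ofReal ?_
    have hinv : ∀ z : ℝ, 1 / 4 ≤ |z| → (√|z|)⁻¹ ≤ 2 := fun z hz ↦ by
      rw [inv_le_comm₀ (Real.sqrt_pos.2 (by linarith)) (by norm_num)]
      exact Real.le_sqrt_of_sq_le (by linarith)
    have h1 : 0 ≤ (√|y|)⁻¹ := by positivity
    have h2 : 0 ≤ (√|y - 1|)⁻¹ := by positivity
    rcases le_total (1 / 2) |y| with h | h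
    · have := hinv y (by linarith)
      nlinarith
    · have h3 : |y - 1| ≥ 1 / 2 := by
        have := abs_sub_abs_le_abs_sub 1 y
        rw [abs_sub_comm 1 y, abs_one] at this
        linarith
      have := hinv (y - 1) (by linarith)
      nlinarith
  have hshift : ∫⁻ y in Set.Icc (-α) α, ENNReal.ofReal (√|y - 1|)⁻¹ < ∞ := by
    have := (measurePreserving_sub_right (volume : Measure ℝ) 1).setLIntegral_comp_preimage_emb
      (MeasurableEquiv.subRight (1 : ℝ)).measurableEmbedding
      (fun x ↦ ENNReal.ofReal (√|x|)⁻¹) (Set.Icc (-(|α| + 1)) (|α| + 1))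
    refine (lintegral_mono_set ?_).trans_lt
      (this.trans_lt (lintegral_inv_sqrt_abs_lt_top (|α| + 1)))
    rintro y ⟨h1, h2⟩
    have := le_abs_self α
    constructor <;> linarith
  have hset : {z : ℝ | |z| ≤ α * |(1 : ℝ)|} = Set.Icc (-α) α := by
    ext z; simp [abs_le]
  unfold cutKernel
  rw [hset, lintegral_indicator measurableSet_Icc]
  refine (setLIntegral_mono (by fun_prop) hle).trans_lt ?_
  rw [lintegral_const_mul _ (by fun_prop), lintegral_add_left (by fun_prop)]
  exact ENNReal.mul_lt_top (by simp)
    (ENNReal.add_lt_top.2 ⟨lintegral_inv_sqrt_abs_lt_top α, hshift⟩)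

theorem lintegral_cutKernel_le (α w : ℝ) :
    ∫⁻ y, cutKernel α w y ≤ ∫⁻ y, cutKernel α 1 y := by
  rcases eq_or_ne w 0 with rfl | hw
  · refine le_of_eq_of_le (lintegral_eq_zero_of_ae_eq_zero (.of_forall fun y ↦ ?_)) zero_le
    unfold cutKernel
    refine Set.indicator_apply_eq_zero.2 fun hy ↦ ?_
    have : y = 0 := by simpa using hy
    simp [this]
  · have h := lintegral_image_eq_lintegral_abs_deriv_mul MeasurableSet.univ
      (f := fun v : ℝ ↦ w * v) (f' := fun _ ↦ w)
      (fun v _ ↦ (((hasDerivAt_id' v).const_mul w).congr_deriv (mul_one w)).hasDerivWithinAt)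
      (mul_right_injective₀ hw).injOn (cutKernel α w)
    rw [Set.image_univ, (mul_left_surjective₀ hw).range_eq] at h
    simp only [Measure.restrict_univ] at h
    rw [h]
    refine lintegral_mono fun y ↦ ?_
    have hwp := abs_pos.2 hw
    have hmem : |w * y| ≤ α * |w| ↔ |y| ≤ α * |(1 : ℝ)| := by
      rw [abs_mul, mul_comm, abs_one, mul_one, mul_le_mul_iff_left₀ hwp]
    unfold cutKernel
    simp only [Set.indicator_apply, Set.mem_ofPred_eq, hmem]
    split_ifs
    · rw [← ENNReal.ofReal_mul hwp.le]
      refine ENNReal.ofReal_le_ofReal (le_of_eq ?_)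
      rw [show w * y - w = w * (y - 1) by ring, abs_mul, abs_mul, Real.sqrt_mul hwp.le,
        Real.sqrt_mul hwp.le, mul_inv, mul_inv]
      have h1 : (√|w|)⁻¹ * (√|w|)⁻¹ = |w|⁻¹ := by
        rw [← mul_inv, Real.mul_self_sqrt hwp.le]
      calc |w| * ((√|w|)⁻¹ * (√|y|)⁻¹ * ((√|w|)⁻¹ * (√|y - 1|)⁻¹))
          = |w| * ((√|w|)⁻¹ * (√|w|)⁻¹) * ((√|y|)⁻¹ * (√|y - 1|)⁻¹) := by ring
        _ = _ := by rw [h1, mul_inv_cancel₀ hwp.ne', one_mul]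
    · simp

theorem measurable_cutKernel (α : ℝ) :
    Measurable fun p : ℝ × ℝ ↦ cutKernel α p.1 p.2 := by
  have hs : MeasurableSet {p : ℝ × ℝ | |p.2| ≤ α * |p.1|} :=
    measurableSet_le (by fun_prop) (by fun_prop)
  exact Measurable.indicator (f := fun p : ℝ × ℝ ↦
    ENNReal.ofReal ((√|p.2|)⁻¹ * (√|p.2 - p.1|)⁻¹)) (by fun_prop) hs

/-- The weight `⟨s⟩^{-2b}`. -/
noncomputable def bracketWeight (b s : ℝ) : ℝ≥0∞ := ENNReal.ofReal ((1 + |s|) ^ (-(2 * b)))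

/-- The convolution of `⟨·⟩^{-2b}` with itself. -/
noncomputable def bracketConv (b q : ℝ) : ℝ≥0∞ :=
  ∫⁻ t, bracketWeight b t * bracketWeight b (q - t)

theorem measurable_bracketWeight (b : ℝ) : Measurable (bracketWeight b) := by
  unfold bracketWeight
  fun_prop

theorem lintegral_bracketWeight_lt_top {b : ℝ} (hb : 1 / 2 < b) :
    ∫⁻ s, bracketWeight b s < ∞ := by
  have := finite_integral_one_add_norm (E := ℝ) (μ := volume) (r := 2 * b)
    (by simp only [Module.finrank_self, Nat.cast_one]; linarith)
  exact this

theorem measurable_bracketConv (b : ℝ) : Measurable (bracketConv b) := by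
  have hJ := measurable_bracketWeight b
  refine Measurable.lintegral_prod_right'
    (f := fun p : ℝ × ℝ ↦ bracketWeight b p.2 * bracketWeight b (p.1 - p.2)) ?_
  fun_prop

theorem lintegral_bracketConv (b : ℝ) :
    ∫⁻ q, bracketConv b q = (∫⁻ s, bracketWeight b s) * ∫⁻ s, bracketWeight b s := by
  have hJ := measurable_bracketWeight b
  unfold bracketConv
  rw [lintegral_lintegral_swap (by fun_prop)]
  have h : ∀ t, ∫⁻ q, bracketWeight b t * bracketWeight b (q - t) =
      bracketWeight b t * ∫⁻ s, bracketWeight b s := fun t ↦ by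
    rw [lintegral_const_mul _ (by fun_prop), lintegral_sub_right_eq_self]
  simp only [h]
  rw [lintegral_mul_const _ hJ]

/-- The region of integration attached to the output frequency `(ξ, μ, τ)`. -/
def region (α ξ μ τ : ℝ) : Set (ℝ × ℝ × ℝ) :=
  {p : ℝ × ℝ × ℝ | p.1 ≠ 0 ∧ ξ - p.1 ≠ 0 ∧ |p.1| ≤ |ξ - p.1| / 4 ∧
    |res α ξ p.1| / α ≤ |sigma α (ξ, μ, τ) - sigma α p - sigma α (sub3 (ξ, μ, τ) p)|}

/-- The integrand attached to the output frequency `(ξ, μ, τ)`. -/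
noncomputable def integrand (α b ξ μ τ : ℝ) (p : ℝ × ℝ × ℝ) : ℝ≥0∞ :=
  ENNReal.ofReal (|p.1|⁻¹ * |ξ - p.1| ^ (α / 2) * (1 + |sigma α p|) ^ (-(2 * b)) *
    (1 + |sigma α (sub3 (ξ, μ, τ) p)|) ^ (-(2 * b)))

theorem measurableSet_region (α ξ μ τ : ℝ) : MeasurableSet (region α ξ μ τ) := by
  have h1 : MeasurableSet {p : ℝ × ℝ × ℝ | p.1 ≠ 0} :=
    (measurableSet_eq_fun (by fun_prop) (by fun_prop)).compl
  have h2 : MeasurableSet {p : ℝ × ℝ × ℝ | ξ - p.1 ≠ 0} :=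
    (measurableSet_eq_fun (by fun_prop) (by fun_prop)).compl
  have h3 : MeasurableSet {p : ℝ × ℝ × ℝ | |p.1| ≤ |ξ - p.1| / 4} :=
    measurableSet_le (by fun_prop) (by fun_prop)
  have h4 : MeasurableSet {p : ℝ × ℝ × ℝ | |res α ξ p.1| / α ≤
      |sigma α (ξ, μ, τ) - sigma α p - sigma α (sub3 (ξ, μ, τ) p)|} := by
    unfold sigma sub3 phi res
    exact measurableSet_le (by fun_prop) (by fun_prop)
  exact h1.inter (h2.inter (h3.inter h4))

theorem lintegral_integrand_le (α b ξ μ τ : ℝ) {x m q : ℝ}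
    (hq : ∀ t, sigma α (x, m, t) + sigma α (sub3 (ξ, μ, τ) (x, m, t)) = q) :
    ∫⁻ t, (region α ξ μ τ).indicator (integrand α b ξ μ τ) (x, m, t) ≤
      ENNReal.ofReal (|x|⁻¹ * |ξ - x| ^ (α / 2)) *
        {s | |res α ξ x| / α ≤ |sigma α (ξ, μ, τ) - s|}.indicator (bracketConv b) q := by
  by_cases hmem : |res α ξ x| / α ≤ |sigma α (ξ, μ, τ) - q|
  · rw [Set.indicator_of_mem (by exact hmem)]
    have hF : ∀ t, integrand α b ξ μ τ (x, m, t) =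
        ENNReal.ofReal (|x|⁻¹ * |ξ - x| ^ (α / 2)) *
          (bracketWeight b (t + phi α x m) * bracketWeight b (q - (t + phi α x m))) := by
      intro t
      have h2 : q - (t + phi α x m) = sigma α (sub3 (ξ, μ, τ) (x, m, t)) := by
        rw [← hq t]
        simp [sigma]
      have h1 : t + phi α x m = sigma α (x, m, t) := rfl
      rw [h2, h1]
      unfold integrand bracketWeight
      rw [← ENNReal.ofReal_mul (by positivity), ← ENNReal.ofReal_mul (by positivity)]
      congr 1
      ring
    calc ∫⁻ t, (region α ξ μ τ).indicator (integrand α b ξ μ τ) (x, m, t)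
        ≤ ∫⁻ t, integrand α b ξ μ τ (x, m, t) :=
          lintegral_mono fun t ↦ Set.indicator_le_self _ _ _
      _ = _ := by
        simp only [hF]
        rw [lintegral_const_mul' _ _ ENNReal.ofReal_ne_top,
          lintegral_add_right_eq_self (fun t ↦ bracketWeight b t * bracketWeight b (q - t))]
        rfl
  · refine le_of_eq_of_le (lintegral_eq_zero_of_ae_eq_zero (.of_forall fun t ↦ ?_)) zero_le
    refine Set.indicator_of_notMem (fun h ↦ hmem ?_) _
    have h4 := h.2.2.2
    rwa [sub_sub, hq t] at h4

theorem lintegral_lintegral_integrand_le {α ξ x : ℝ} (b μ τ : ℝ) (hα : 4 ≤ α) (hξ : ξ ≠ 0)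
    (hx : |x| ≤ |ξ - x| / 4) (hx0 : x ≠ 0) :
    ∫⁻ m, ∫⁻ t, (region α ξ μ τ).indicator (integrand α b ξ μ τ) (x, m, t) ≤
      ∫⁻ s, ENNReal.ofReal √(4 / 3 * ((α + 1) * 2 ^ α)) * bracketConv b s *
        (ENNReal.ofReal |(α + 1) * (|ξ - x| ^ α - |x| ^ α)| *
          cutKernel α (sigma α (ξ, μ, τ) - s) (res α ξ x)) := by
  have hz : ξ - x ≠ 0 := abs_pos.1 (abs_sub_pos_of_low_freq hξ hx)
  set a := sigma α (ξ, μ, τ) - res α ξ x with ha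
  set κ := ξ / (x * (ξ - x))
  have hκ0 : κ ≠ 0 := div_ne_zero hξ (mul_ne_zero hx0 hz)
  set W := {s | |res α ξ x| / α ≤ |sigma α (ξ, μ, τ) - s|}.indicator (bracketConv b) with hW
  set P := ENNReal.ofReal (|x|⁻¹ * |ξ - x| ^ (α / 2)) with hP
  calc ∫⁻ m, ∫⁻ t, (region α ξ μ τ).indicator (integrand α b ξ μ τ) (x, m, t)
      ≤ ∫⁻ m, P * W (a + κ * (m - x * μ / ξ) ^ 2) := lintegral_mono fun m ↦
        lintegral_integrand_le α b ξ μ τ fun t ↦ sigma_add_sigma_sub3 hξ hx0 hz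
    _ = P * ∫⁻ v, W (a + κ * v ^ 2) := by
      rw [lintegral_const_mul' _ _ ENNReal.ofReal_ne_top,
        lintegral_sub_right_eq_self (fun v ↦ W (a + κ * v ^ 2))]
    _ ≤ P * ∫⁻ y, W (a + y) * ENNReal.ofReal (√|κ * y|)⁻¹ :=
      mul_le_mul_right (lintegral_comp_mul_sq_le hκ0 fun y ↦ W (a + y)) _
    _ = P * ∫⁻ s, W s * ENNReal.ofReal (√|κ * (s - a)|)⁻¹ := by
      rw [← lintegral_add_left_eq_self (fun s ↦ W s * ENNReal.ofReal (√|κ * (s - a)|)⁻¹) a]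
      simp only [add_sub_cancel_left]
    _ = ∫⁻ s, P * (W s * ENNReal.ofReal (√|κ * (s - a)|)⁻¹) :=
      (lintegral_const_mul' _ _ ENNReal.ofReal_ne_top).symm
    _ ≤ _ := by
      refine lintegral_mono fun s ↦ ?_
      by_cases hs : |res α ξ x| / α ≤ |sigma α (ξ, μ, τ) - s|
      · have hs' : |res α ξ x| ≤ α * |sigma α (ξ, μ, τ) - s| := by
          rwa [div_le_iff₀' (by linarith)] at hs
        rw [hW, Set.indicator_of_mem (by exact hs), cutKernel,
          Set.indicator_of_mem (by exact hs'),
          show res α ξ x - (sigma α (ξ, μ, τ) - s) = s - a by rw [ha]; ring,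
          ← ENNReal.ofReal_mul (abs_nonneg _), mul_left_comm, hP,
          ← ENNReal.ofReal_mul (by positivity),
          mul_right_comm (ENNReal.ofReal √_), ← ENNReal.ofReal_mul (Real.sqrt_nonneg _),
          mul_comm (bracketConv b s)]
        exact mul_le_mul_left (ENNReal.ofReal_le_ofReal (prefactor_le hα hξ hx hx0 _)) _
      · rw [hW, Set.indicator_of_notMem (by exact hs)]
        simp

theorem lintegral_deriv_mul_cutKernel_le {α ξ : ℝ} (hα : 4 ≤ α) (hξ : ξ ≠ 0) (w : ℝ) :
    ∫⁻ x in {x : ℝ | |x| ≤ |ξ - x| / 4}, ENNReal.ofReal |(α + 1) * (|ξ - x| ^ α - |x| ^ α)| *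
      cutKernel α w (res α ξ x) ≤ ∫⁻ y, cutKernel α 1 y := by
  rw [← lintegral_image_eq_lintegral_abs_deriv_mul
    (measurableSet_le (by fun_prop) (by fun_prop))
    (fun x _ ↦ (hasDerivAt_res (by linarith) ξ x).hasDerivWithinAt)
    (strictMonoOn_res hα hξ).injOn (cutKernel α w)]
  exact (setLIntegral_le_lintegral _ _).trans (lintegral_cutKernel_le α w)

theorem setLIntegral_integrand_le {α ξ : ℝ} (b μ τ : ℝ) (hα : 4 ≤ α) (hξ : ξ ≠ 0) :
    ∫⁻ p in region α ξ μ τ, integrand α b ξ μ τ p ≤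
      ENNReal.ofReal √(4 / 3 * ((α + 1) * 2 ^ α)) *
        ((∫⁻ s, bracketWeight b s) * ∫⁻ s, bracketWeight b s) * ∫⁻ y, cutKernel α 1 y := by
  set A : Set ℝ := {x : ℝ | |x| ≤ |ξ - x| / 4}
  have hA : MeasurableSet A := measurableSet_le (by fun_prop) (by fun_prop)
  have hG := measurable_bracketConv b
  set K := ENNReal.ofReal √(4 / 3 * ((α + 1) * 2 ^ α))
  set D : ℝ → ℝ≥0∞ := fun x ↦ ENNReal.ofReal |(α + 1) * (|ξ - x| ^ α - |x| ^ α)|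
  have hD : Measurable D := by fun_prop
  have hres : Measurable (res α ξ) := by unfold res; fun_prop
  have hcut : Measurable fun p : ℝ × ℝ ↦
      cutKernel α (sigma α (ξ, μ, τ) - p.2) (res α ξ p.1) :=
    (measurable_cutKernel α).comp
      (f := fun p : ℝ × ℝ ↦ (sigma α (ξ, μ, τ) - p.2, res α ξ p.1)) (by fun_prop)
  calc ∫⁻ p in region α ξ μ τ, integrand α b ξ μ τ p
      = ∫⁻ p, (region α ξ μ τ).indicator (integrand α b ξ μ τ) p :=
        (lintegral_indicator (measurableSet_region α ξ μ τ) _).symm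
    _ ≤ ∫⁻ x, ∫⁻ r, (region α ξ μ τ).indicator (integrand α b ξ μ τ) (x, r) :=
        lintegral_prod_le _
    _ ≤ ∫⁻ x, ∫⁻ m, ∫⁻ t, (region α ξ μ τ).indicator (integrand α b ξ μ τ) (x, m, t) :=
        lintegral_mono fun x ↦ lintegral_prod_le _
    _ ≤ ∫⁻ x, A.indicator (fun x ↦ ∫⁻ s, K * bracketConv b s *
          (D x * cutKernel α (sigma α (ξ, μ, τ) - s) (res α ξ x))) x := by
        refine lintegral_mono fun x ↦ ?_
        by_cases hx : x ≠ 0 ∧ x ∈ A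
        · rw [Set.indicator_of_mem hx.2]
          exact lintegral_lintegral_integrand_le b μ τ hα hξ hx.2 hx.1
        · have h0 : ∀ m t, (region α ξ μ τ).indicator (integrand α b ξ μ τ) (x, m, t) = 0 :=
            fun m t ↦ Set.indicator_of_notMem (fun h ↦ hx ⟨h.1, h.2.2.1⟩) _
          simp [h0]
    _ = ∫⁻ x in A, ∫⁻ s, K * bracketConv b s *
          (D x * cutKernel α (sigma α (ξ, μ, τ) - s) (res α ξ x)) := lintegral_indicator hA _
    _ = ∫⁻ s, ∫⁻ x in A, K * bracketConv b s *
          (D x * cutKernel α (sigma α (ξ, μ, τ) - s) (res α ξ x)) := by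
        refine lintegral_lintegral_swap (Measurable.aemeasurable ?_)
        exact ((hG.comp measurable_snd).const_mul K).mul ((hD.comp measurable_fst).mul hcut)
    _ ≤ ∫⁻ s, K * bracketConv b s * ∫⁻ y, cutKernel α 1 y := by
        refine lintegral_mono fun s ↦ ?_
        rw [lintegral_const_mul]
        · exact mul_le_mul_right (lintegral_deriv_mul_cutKernel_le hα hξ _) _
        · exact hD.mul (hcut.comp (f := fun x : ℝ ↦ (x, s)) (by fun_prop))
    _ = _ := by
        rw [lintegral_mul_const _ (hG.const_mul K), lintegral_const_mul _ hG,
          lintegral_bracketConv]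

/-- **Paper's key kernel bound (2.015) in the proof of Lemma 2.4.**
For `α ≥ 4` and `b > 1/2` there is `C > 0` such that for every `(ξ, μ, τ)` with `ξ ≠ 0`,
the integral `I(ξ, μ, τ)` of `|ξ₁|^{-1} |ξ₂|^{α/2} ⟨σ₁⟩^{-2b} ⟨σ₂⟩^{-2b}` over the region
`{(ξ₁, μ₁, τ₁) : ξ₁ ≠ 0, ξ₂ := ξ − ξ₁ ≠ 0, |ξ₁| ≤ |ξ₂|/4, |σ − σ₁ − σ₂| ≥ |Δ|/α}`
is at most `C`. -/
theorem stmt9 (α b : ℝ) (hα : 4 ≤ α) (hb : 1 / 2 < b) :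
    ∃ C : ℝ, 0 < C ∧ ∀ ξ μ τ : ℝ, ξ ≠ 0 →
      (∫⁻ p : ℝ × ℝ × ℝ in
          {p : ℝ × ℝ × ℝ | p.1 ≠ 0 ∧ ξ - p.1 ≠ 0 ∧ |p.1| ≤ |ξ - p.1| / 4 ∧
            |res α ξ p.1| / α ≤
              |sigma α (ξ, μ, τ) - sigma α p - sigma α (sub3 (ξ, μ, τ) p)|},
          ENNReal.ofReal (|p.1|⁻¹ * |ξ - p.1| ^ (α / 2) *
            (1 + |sigma α p|) ^ (-(2 * b)) *
            (1 + |sigma α (sub3 (ξ, μ, τ) p)|) ^ (-(2 * b)))) ≤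
        ENNReal.ofReal C := by
  have hJ := lintegral_bracketWeight_lt_top hb
  set M := ENNReal.ofReal √(4 / 3 * ((α + 1) * 2 ^ α)) *
    ((∫⁻ s, bracketWeight b s) * ∫⁻ s, bracketWeight b s) * ∫⁻ y, cutKernel α 1 y
  have hM : M < ∞ := ENNReal.mul_lt_top
    (ENNReal.mul_lt_top ENNReal.ofReal_lt_top (ENNReal.mul_lt_top hJ hJ))
    (lintegral_cutKernel_one_lt_top α)
  refine ⟨M.toReal + 1, by positivity, fun ξ μ τ hξ ↦ ?_⟩
  calc ∫⁻ p in region α ξ μ τ, integrand α b ξ μ τ p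
      ≤ M := setLIntegral_integrand_le b μ τ hα hξ
    _ = ENNReal.ofReal M.toReal := (ENNReal.ofReal_toReal hM.ne).symm
    _ ≤ ENNReal.ofReal (M.toReal + 1) := ENNReal.ofReal_le_ofReal (by linarith)
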